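/- Let q ≥ 9 and let t(q) be the smallest size of an almost complete subset of a nondegenerate conic in PG(2,q). Then t(q) < √(q(3 ln q + ln ln q + ln 3)) + √(q/(3 ln q)) + 4. -/

import Mathlib

open scoped Classical

noncomputable section

/-- The projective plane `PG(2,q)` over a field `F` (with `q = #F`). -/
abbrev PG2 (F : Type) [Field F] : Type := Projectivization F (Fin 3 → F)

variable {F : Type} [Field F] [Fintype F]

/-- Three points of `PG(2,q)` are collinear if they lie in a common
projective line, i.e. a common 2-dimensional linear subspace. -/
def Collinear3 (a b c : PG2 F) : Prop :=
  ∃ W : Submodule F (Fin 3 → F), Module.finrank F W = 2 ∧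
    a.rep ∈ W ∧ b.rep ∈ W ∧ c.rep ∈ W

/-- A (projective) line of `PG(2,q)`: the point set of a 2-dimensional linear subspace. -/
def IsLine (L : Set (PG2 F)) : Prop :=
  ∃ W : Submodule F (Fin 3 → F), Module.finrank F W = 2 ∧ L = {p : PG2 F | p.rep ∈ W}

/-- An arc: no three distinct points collinear. -/
def IsArc (C : Set (PG2 F)) : Prop :=
  ∀ a ∈ C, ∀ b ∈ C, ∀ c ∈ C, a ≠ b → b ≠ c → a ≠ c → ¬ Collinear3 a b c

/-- A nondegenerate conic: the zero locus of a quadratic form which is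
a `(q+1)`-arc. -/
def IsConic (C : Set (PG2 F)) : Prop :=
  (∃ Q : QuadraticForm F (Fin 3 → F), C = {p : PG2 F | Q p.rep = 0}) ∧
  IsArc C ∧ C.ncard = Fintype.card F + 1

/-- A tangent of `C`: a line meeting `C` in exactly one point. -/
def IsTangent (C L : Set (PG2 F)) : Prop := IsLine L ∧ (L ∩ C).ncard = 1

/-- A bisecant of `C`: a line meeting `C` in exactly two points. -/
def IsBisecant (C L : Set (PG2 F)) : Prop := IsLine L ∧ (L ∩ C).ncard = 2

/-- A point `P` is covered by a point set `K` if `P` is collinear with two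
distinct points of `K` (i.e. `P` lies on a bisecant of `K`). -/
def Covered (K : Set (PG2 F)) (P : PG2 F) : Prop :=
  ∃ a ∈ K, ∃ b ∈ K, a ≠ b ∧ Collinear3 a b P

/-- `O` is a nucleus of `C` if every tangent of `C` passes through `O`. -/
def IsNucleus (C : Set (PG2 F)) (O : PG2 F) : Prop :=
  ∀ L : Set (PG2 F), IsTangent C L → O ∈ L

/-- The point set `M_q`: all points off `C` (and also off the nucleus when `q` is even). -/
def Mset (C : Set (PG2 F)) : Set (PG2 F) :=
  if Even (Fintype.card F) then (Set.univ \ C) \ {O : PG2 F | IsNucleus C O}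
  else Set.univ \ C

/-- An almost complete subset of the conic `C`: a proper subset of `C`
covering every point of `M_q`. -/
def IsACSubset (C S : Set (PG2 F)) : Prop :=
  S ⊂ C ∧ ∀ P ∈ Mset C, Covered S P

/-- The smallest size of an almost complete subset of `C`. -/
noncomputable def tAC (C : Set (PG2 F)) : ℕ :=
  sInf {n : ℕ | ∃ S : Set (PG2 F), IsACSubset C S ∧ S.ncard = n}

theorem aux_expand (Q : QuadraticForm F (Fin 3 → F)) (x y : Fin 3 → F) (t : F) :
    Q (x + t • y) = Q x + t * t * Q y + t * Q.polarBilin x y := by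
  rw [QuadraticMap.map_add Q, QuadraticMap.map_smul, QuadraticMap.polar_smul_right]
  simp [QuadraticMap.polarBilin_apply_apply]

theorem aux_rep_mem (W : Submodule F (Fin 3 → F)) (x : Fin 3 → F) (hx : x ≠ 0) :
    (Projectivization.mk F x hx).rep ∈ W ↔ x ∈ W := by
  obtain ⟨a, ha⟩ := Projectivization.exists_smul_eq_mk_rep F x hx
  rw [← ha]
  exact Submodule.smul_mem_iff' (p := W) a

theorem aux_rep_Q (Q : QuadraticForm F (Fin 3 → F)) (x : Fin 3 → F) (hx : x ≠ 0) :
    Q (Projectivization.mk F x hx).rep = 0 ↔ Q x = 0 := by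
  obtain ⟨a, ha⟩ := Projectivization.exists_smul_eq_mk_rep F x hx
  rw [← ha, Units.smul_def, QuadraticMap.map_smul]
  simp

theorem aux_eq_of_smul (A : PG2 F) (x : Fin 3 → F) (hx : x ≠ 0)
    (h : Projectivization.mk F x hx = A) : ∃ c : F, c • A.rep = x := by
  rw [← A.mk_rep] at h
  exact (Projectivization.mk_eq_mk_iff' F _ _ _ _).1 h

theorem aux_line (A P : PG2 F) (h : A ≠ P) :
    Module.finrank F (Submodule.span F {A.rep, P.rep}) = 2 := by
  have hi := Projectivization.linearIndependent_pair_iff_ne.2 h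
  have := finrank_span_eq_card hi
  rw [Matrix.range_cons, Matrix.range_cons, Matrix.range_empty, Set.union_empty,
    Set.singleton_union] at this
  simpa using this

theorem aux_span_ne (A P : PG2 F) (h : A ≠ P) (c : F) : P.rep ≠ c • A.rep := by
  intro he
  apply h
  rw [← A.mk_rep, ← P.mk_rep]
  exact ((Projectivization.mk_eq_mk_iff' F _ _ _ _).2 ⟨c, he.symm⟩).symm

theorem aux_tangents (C : Set (PG2 F)) (hC : IsConic C) (Q : QuadraticForm F (Fin 3 → F))
    (hQ : C = {p : PG2 F | Q p.rep = 0}) (P : PG2 F) (hP : P ∈ Mset C) :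
    {A ∈ C | Q.polarBilin P.rep A.rep = 0}.ncard ≤ 2 := by
  obtain ⟨-, harc, hcard⟩ := hC
  have hPC : P ∉ C := by
    unfold Mset at hP
    split_ifs at hP with he
    · exact hP.1.2
    · exact hP.2
  have hv : Q P.rep ≠ 0 := by
    intro h; apply hPC; rw [hQ]; exact h
  by_cases h0 : Q.polarBilin P.rep = 0
  · exfalso
    have h2 : (2 : F) = 0 := by
      have h1 : Q.polarBilin P.rep P.rep = 0 := by rw [h0]; rfl
      rw [QuadraticMap.polarBilin_apply_apply, QuadraticMap.polar_self] at h1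
      simpa [hv] using h1
    have heven : Even (Fintype.card F) := by
      have hch : ringChar F = 2 := by
        have : ringChar F ∣ 2 := (ringChar.spec F 2).1 (by exact_mod_cast h2)
        rcases (Nat.dvd_prime Nat.prime_two).1 this with h | h
        · exact absurd h (CharP.ringChar_ne_one)
        · exact h
      exact Nat.even_iff.2 ((FiniteField.even_card_iff_char_two).1 hch)
    rw [Mset, if_pos heven] at hP
    apply hP.2
    rintro L ⟨⟨W, hW, rfl⟩, hL⟩
    by_contra hPW
    change P.rep ∉ W at hPW
    obtain ⟨A, hA⟩ := Set.ncard_eq_one.1 hL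
    have hAm : A ∈ {p : PG2 F | p.rep ∈ W} ∩ C := by rw [hA]; rfl
    obtain ⟨haW, haC⟩ := hAm
    change A.rep ∈ W at haW
    have hQa : Q A.rep = 0 := by rw [hQ] at haC; exact haC
    have hker : ∀ w ∈ W, Q.polarBilin A.rep w = 0 := by
      intro w hw
      by_contra hne
      have hns : ∀ c : F, c • A.rep ≠ w := by
        rintro c rfl
        apply hne
        rw [map_smul, QuadraticMap.polarBilin_apply_apply, QuadraticMap.polar_self, hQa]
        simp
      set b := Q.polarBilin A.rep w with hb
      have hb' : Q.polarBilin w A.rep = b := by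
        rw [hb, QuadraticMap.polarBilin_apply_apply, QuadraticMap.polarBilin_apply_apply,
          QuadraticMap.polar_comm]
      have hu0 : w + (-(Q w / b)) • A.rep ≠ 0 := by
        intro h
        apply hns (Q w / b)
        rw [neg_smul, ← sub_eq_add_neg, sub_eq_zero] at h
        exact h.symm
      have hm : Projectivization.mk F _ hu0 ∈ {p : PG2 F | p.rep ∈ W} ∩ C := by
        refine ⟨?_, ?_⟩
        · change (Projectivization.mk F _ hu0).rep ∈ W
          rw [aux_rep_mem]
          exact W.add_mem hw (W.smul_mem _ haW)
        · rw [hQ]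
          change Q (Projectivization.mk F _ hu0).rep = 0
          rw [aux_rep_Q, aux_expand, hQa, hb']
          field_simp
          ring
      rw [hA] at hm
      obtain ⟨c, hc⟩ := aux_eq_of_smul A _ hu0 hm
      apply hns (c + Q w / b)
      rw [add_smul, hc]
      simp
    have hAv : Q.polarBilin A.rep P.rep = 0 := by
      rw [QuadraticMap.polarBilin_apply_apply, QuadraticMap.polar_comm,
        ← QuadraticMap.polarBilin_apply_apply, h0]; rfl
    have htop : Q.polarBilin A.rep = 0 := by
      rw [← LinearMap.ker_eq_top]
      have hlt : W < LinearMap.ker (Q.polarBilin A.rep) := by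
        refine lt_of_le_of_ne (fun w hw => hker w hw) ?_
        intro h
        apply hPW
        rw [h]; exact hAv
      have := Submodule.finrank_lt_finrank_of_lt hlt
      apply Submodule.eq_top_of_finrank_eq
      have h3 := Submodule.finrank_le (LinearMap.ker (Q.polarBilin A.rep))
      simp only [Module.finrank_fin_fun] at h3 ⊢
      omega
    have : 1 < C.ncard := by
      rw [hcard]; have := Fintype.card_pos (α := F); omega
    obtain ⟨B, hB, hBA⟩ := Set.exists_ne_of_one_lt_ncard this A
    have hQb : Q B.rep = 0 := by rw [hQ] at hB; exact hB
    have hu0 : B.rep + (1 : F) • A.rep ≠ 0 := by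
      intro h
      apply aux_span_ne A B hBA.symm (-1)
      rw [neg_smul]; exact eq_neg_of_add_eq_zero_left h
    have hd : Projectivization.mk F _ hu0 ∈ C := by
      rw [hQ]
      change Q (Projectivization.mk F _ hu0).rep = 0
      rw [aux_rep_Q, aux_expand, hQa, hQb, QuadraticMap.polarBilin_apply_apply,
        QuadraticMap.polar_comm, ← QuadraticMap.polarBilin_apply_apply, htop]
      simp
    refine harc A haC B hB _ hd hBA.symm ?_ ?_ ⟨_, aux_line A B hBA.symm, ?_, ?_, ?_⟩
    · intro h
      obtain ⟨c, hc⟩ := aux_eq_of_smul B _ hu0 h.symm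
      apply aux_span_ne B A hBA (c - 1)
      rw [sub_smul, hc]; simp
    · intro h
      obtain ⟨c, hc⟩ := aux_eq_of_smul A _ hu0 h.symm
      apply aux_span_ne A B hBA.symm (c - 1)
      rw [sub_smul, hc]; simp
    · exact Submodule.subset_span (by simp)
    · exact Submodule.subset_span (by simp)
    · rw [aux_rep_mem]
      exact Submodule.add_mem _ (Submodule.subset_span (by simp))
        (Submodule.smul_mem _ _ (Submodule.subset_span (by simp)))
  · by_contra hgt
    push Not at hgt
    have hfin : C.Finite := Set.finite_of_ncard_pos (by omega)
    obtain ⟨a, ha, b, hb, c, hc, hab, hac, hbc⟩ :=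
      (Set.two_lt_ncard (hfin.subset (fun x hx => hx.1))).1 hgt
    refine harc a ha.1 b hb.1 c hc.1 hab hbc hac
      ⟨LinearMap.ker (Q.polarBilin P.rep), ?_, ha.2, hb.2, hc.2⟩
    have := Module.Dual.finrank_ker_add_one_of_ne_zero (f := Q.polarBilin P.rep) h0
    rw [Module.finrank_fin_fun] at this
    omega

theorem aux_cover (C : Set (PG2 F)) (hC : IsConic C) (S : Set (PG2 F)) (hS : S ⊆ C)
    (P : PG2 F) (hP : P ∈ Mset C) (hu : ¬ Covered S P) :
    S.ncard ≤ {A ∈ C \ S | Covered (insert A S) P}.ncard + 2 := by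
  obtain ⟨⟨Q, hQ⟩, harc, hcard⟩ := id hC
  have hfin : C.Finite := Set.finite_of_ncard_pos (by omega)
  have hT := aux_tangents C hC Q hQ P hP
  set T := {A ∈ C | Q.polarBilin P.rep A.rep = 0} with hTdef
  have hTfin : T.Finite := hfin.subset (fun x hx => hx.1)
  have hPC : P ∉ C := by
    unfold Mset at hP
    split_ifs at hP with he
    · exact hP.1.2
    · exact hP.2
  have hv : Q P.rep ≠ 0 := by
    intro h; apply hPC; rw [hQ]; exact h
  let r : (Fin 3 → F) →ₗ[F] (Fin 3 → F) :=
    LinearMap.id + (-(Q P.rep)⁻¹ • Q.polarBilin P.rep).smulRight P.rep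
  have hr : ∀ x, r x = x + (-(Q P.rep)⁻¹ * Q.polarBilin P.rep x) • P.rep := by
    intro x; simp [r]
  have hself : Q.polarBilin P.rep P.rep = 2 * Q P.rep := by
    rw [QuadraticMap.polarBilin_apply_apply, QuadraticMap.polar_self]; simp
  have hrr : ∀ x, r (r x) = x := by
    intro x
    rw [hr (r x), hr x, map_add, map_smul, hself, add_assoc, ← add_smul]
    have : (-(Q P.rep)⁻¹ * Q.polarBilin P.rep x + -(Q P.rep)⁻¹ *
      (Q.polarBilin P.rep x + (-(Q P.rep)⁻¹ * Q.polarBilin P.rep x) • (2 * Q P.rep))) = 0 := by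
      rw [smul_eq_mul]; field_simp; ring
    rw [this]; simp
  have hinj : Function.Injective r := Function.LeftInverse.injective hrr
  have hQr : ∀ x, Q (r x) = Q x := by
    intro x
    rw [hr, aux_expand]
    have : Q.polarBilin x P.rep = Q.polarBilin P.rep x := by
      rw [QuadraticMap.polarBilin_apply_apply, QuadraticMap.polarBilin_apply_apply,
          QuadraticMap.polar_comm]
    rw [this]
    field_simp; ring
  have hφinj : Function.Injective (Projectivization.map r hinj) :=
    Projectivization.map_injective r hinj
  have hφ : ∀ A : PG2 F, Projectivization.map r hinj A = Projectivization.mk F (r A.rep)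
      (fun h => A.rep_nonzero (hinj (by rw [h, map_zero]))) := by
    intro A
    conv_lhs => rw [← A.mk_rep]
    rw [Projectivization.map_mk]
  have himg : Projectivization.map r hinj '' (S \ T) ⊆ {A ∈ C \ S | Covered (insert A S) P} := by
    rintro _ ⟨A, ⟨hAS, hAT⟩, rfl⟩
    have hAC := hS hAS
    have hb : Q.polarBilin P.rep A.rep ≠ 0 := fun h => hAT ⟨hAC, h⟩
    have hAP : A ≠ P := fun h => hPC (h ▸ hAC)
    have hD : Projectivization.map r hinj A ∈ C := by
      rw [hφ, hQ]
      change Q (Projectivization.mk F _ _).rep = 0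
      rw [aux_rep_Q, hQr]
      rw [hQ] at hAC; exact hAC
    have hne : A ≠ Projectivization.map r hinj A := by
      intro h
      rw [hφ] at h
      obtain ⟨c, hc⟩ := aux_eq_of_smul A _ _ h.symm
      rw [hr] at hc
      have ht : (-(Q P.rep)⁻¹ * Q.polarBilin P.rep A.rep) ≠ 0 := by
        apply mul_ne_zero _ hb
        simpa using hv
      apply aux_span_ne A P hAP ((-(Q P.rep)⁻¹ * Q.polarBilin P.rep A.rep)⁻¹ * (c - 1))
      rw [mul_smul, sub_smul, hc, one_smul, add_sub_cancel_left, smul_smul,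
        inv_mul_cancel₀ ht, one_smul]
    have hcol : Collinear3 A (Projectivization.map r hinj A) P := by
      refine ⟨_, aux_line A P hAP, Submodule.subset_span (by simp), ?_,
        Submodule.subset_span (by simp)⟩
      rw [hφ, aux_rep_mem, hr]
      exact Submodule.add_mem _ (Submodule.subset_span (by simp))
        (Submodule.smul_mem _ _ (Submodule.subset_span (by simp)))
    refine ⟨⟨hD, fun hDS => hu ⟨A, hAS, _, hDS, hne, hcol⟩⟩,
      A, Set.mem_insert_of_mem _ hAS, _, Set.mem_insert _ _, hne, hcol⟩
  have h1 := Set.ncard_le_ncard himg (hfin.subset (fun x hx => hx.1.1))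
  rw [Set.ncard_image_of_injective _ hφinj] at h1
  have h2 := Set.ncard_le_ncard_sdiff_add_ncard S T hTfin
  exact le_trans h2 (add_le_add h1 hT)

theorem aux_card_M (C : Set (PG2 F)) (hC : IsConic C) :
    (Mset C).ncard ≤ Fintype.card F ^ 2 := by
  have hfin : Finite (PG2 F) := inferInstance
  have h1 := Projectivization.card_of_finrank F (Fin 3 → F) (n := 3) (by simp)
  have hsub : Mset C ⊆ Cᶜ := by
    intro P hP
    unfold Mset at hP
    split_ifs at hP with he
    · exact hP.1.2
    · exact hP.2
  have h2 := Set.ncard_le_ncard hsub (Set.toFinite _)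
  have h3 := Set.ncard_add_ncard_compl C
  rw [hC.2.2, h1] at h3
  simp [Finset.sum_range_succ, Nat.card_eq_fintype_card] at h3
  omega

/-- Points of `Mset C` not yet covered by `S`. -/
def auxU (C S : Set (PG2 F)) : Set (PG2 F) := {P ∈ Mset C | ¬ Covered S P}

theorem aux_covered_mono {S S' : Set (PG2 F)} (h : S ⊆ S') {P : PG2 F} (hP : Covered S P) :
    Covered S' P := by
  obtain ⟨a, ha, b, hb, hh⟩ := hP
  exact ⟨a, h ha, b, h hb, hh⟩

theorem aux_avg {α β : Type*} (s : Finset α) (t : Finset β) (r : α → β → Prop) (k : ℕ)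
    (hs : s.Nonempty) (h : ∀ b ∈ t, k ≤ (s.filter (fun a => r a b)).card) :
    ∃ a ∈ s, t.card * k ≤ s.card * (t.filter (fun b => r a b)).card := by
  by_contra hcon
  push Not at hcon
  have h1 := Finset.sum_card_bipartiteAbove_eq_sum_card_bipartiteBelow (s := s) (t := t) r
  have h2 : t.card * k ≤ ∑ b ∈ t, (s.bipartiteBelow r b).card := by
    rw [← smul_eq_mul]
    exact Finset.card_nsmul_le_sum _ _ _ h
  have h3 : ∑ a ∈ s, s.card * (t.bipartiteAbove r a).card < ∑ a ∈ s, t.card * k :=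
    Finset.sum_lt_sum_of_nonempty hs hcon
  rw [← Finset.mul_sum, h1, Finset.sum_const, smul_eq_mul] at h3
  have := Nat.mul_le_mul_left s.card h2
  omega

theorem aux_step (C : Set (PG2 F)) (hC : IsConic C) (S : Set (PG2 F)) (hS : S ⊆ C) (n : ℕ)
    (hn : S.ncard = n + 2) (hnq : n + 2 ≤ Fintype.card F) :
    ∃ A ∈ C \ S, ((auxU C (insert A S)).ncard : ℝ) ≤
      (auxU C S).ncard * Real.exp (-(n / ((Fintype.card F : ℝ) - 1))) := by
  have hfin : Finite (PG2 F) := inferInstance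
  let _ : Fintype (PG2 F) := Fintype.ofFinite _
  have hcd : (C \ S).ncard + S.ncard = C.ncard := Set.ncard_sdiff_add_ncard_of_subset hS
  rw [hC.2.2, hn] at hcd
  have hne : (C \ S).toFinset.Nonempty := by
    rw [Set.toFinset_nonempty]
    apply (Set.ncard_pos).1
    omega
  obtain ⟨A, hA, hAle⟩ := aux_avg (C \ S).toFinset (auxU C S).toFinset
    (fun A P => Covered (insert A S) P) n hne (by
      intro P hP
      rw [Set.mem_toFinset] at hP
      have := aux_cover C hC S hS P hP.1 hP.2
      rw [hn] at this
      have e : {A ∈ C \ S | Covered (insert A S) P} =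
        (((C \ S).toFinset.filter (fun A => Covered (insert A S) P) : Finset (PG2 F)) :
          Set (PG2 F)) := by
        ext x; simp
      rw [e, Set.ncard_coe_finset] at this
      omega)
  rw [Set.mem_toFinset] at hA
  refine ⟨A, hA, ?_⟩
  rw [← Set.ncard_eq_toFinset_card', ← Set.ncard_eq_toFinset_card'] at hAle
  have hsplit := Finset.card_filter_add_card_filter_not (s := (auxU C S).toFinset)
    (fun P => Covered (insert A S) P)
  rw [← Set.ncard_eq_toFinset_card'] at hsplit
  have e2 : auxU C (insert A S) = (((auxU C S).toFinset.filter
      (fun P => ¬ Covered (insert A S) P) : Finset (PG2 F)) : Set (PG2 F)) := by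
    ext x
    rw [Finset.coe_filter, Set.mem_setOf_eq, Set.mem_toFinset]
    constructor
    · rintro ⟨h1, h2⟩
      exact ⟨⟨h1, fun h => h2 (aux_covered_mono (Set.subset_insert _ _) h)⟩, h2⟩
    · rintro ⟨⟨h1, _⟩, h2⟩
      exact ⟨h1, h2⟩
  have e3 : (auxU C (insert A S)).ncard = ((auxU C S).toFinset.filter
      (fun P => ¬ Covered (insert A S) P)).card := by
    rw [e2, Set.ncard_coe_finset]
  rw [e3]
  generalize ((auxU C S).toFinset.filter (fun P => ¬ Covered (insert A S) P)).card = y at *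
  generalize ((auxU C S).toFinset.filter (fun P => Covered (insert A S) P)).card = x at *
  generalize (auxU C S).ncard = u at *
  generalize (C \ S).ncard = m at *
  generalize Fintype.card F = q at *
  have hm : m + 1 ≤ q := by omega
  have hq : (0 : ℝ) < (q : ℝ) - 1 := by
    have : (2 : ℝ) ≤ q := by exact_mod_cast (by omega : 2 ≤ q)
    linarith
  have h1 : (u : ℝ) * n ≤ ((q : ℝ) - 1) * x := by
    have a1 : (u : ℝ) * n ≤ m * x := by exact_mod_cast hAle
    have a2 : (m : ℝ) + 1 ≤ q := by exact_mod_cast hm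
    have a3 : (m : ℝ) * x ≤ ((q : ℝ) - 1) * x :=
      mul_le_mul_of_nonneg_right (by linarith) (Nat.cast_nonneg _)
    linarith
  have h2 : (x : ℝ) + y = u := by exact_mod_cast hsplit
  have h3 : (u : ℝ) * (n / ((q : ℝ) - 1)) ≤ x := by
    rw [← mul_div_assoc, div_le_iff₀ hq]; linarith
  have h4 := Real.add_one_le_exp (-((n : ℝ) / ((q : ℝ) - 1)))
  have h5 := mul_le_mul_of_nonneg_left h4 (Nat.cast_nonneg (α := ℝ) u)
  nlinarith

theorem aux_greedy (C : Set (PG2 F)) (hC : IsConic C) (n : ℕ)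
    (hnq : n + 2 ≤ Fintype.card F) :
    ∃ S ⊆ C, S.ncard = n + 2 ∧ ((auxU C S).ncard : ℝ) ≤
      (Fintype.card F : ℝ) ^ 2 *
        Real.exp (-((n : ℝ) * (n - 1) / 2 / ((Fintype.card F : ℝ) - 1))) := by
  have hfin : Finite (PG2 F) := inferInstance
  induction n with
  | zero =>
    obtain ⟨S, hS, hc⟩ := Set.exists_subset_card_eq (s := C) (n := 2) (by rw [hC.2.2]; omega)
    refine ⟨S, hS, by simpa using hc, ?_⟩
    have h1 : (auxU C S).ncard ≤ (Mset C).ncard :=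
      Set.ncard_le_ncard (fun x hx => hx.1) (Set.toFinite _)
    have h2 := h1.trans (aux_card_M C hC)
    simp only [Nat.cast_zero, zero_mul, zero_div, neg_zero, Real.exp_zero, mul_one]
    exact_mod_cast h2
  | succ n ih =>
    obtain ⟨S, hS, hc, hu⟩ := ih (by omega)
    obtain ⟨A, hA, hle⟩ := aux_step C hC S hS n hc (by omega)
    refine ⟨insert A S, Set.insert_subset hA.1 hS, ?_, ?_⟩
    · rw [Set.ncard_insert_of_notMem hA.2 (Set.toFinite _), hc]
    · refine hle.trans ((mul_le_mul_of_nonneg_right hu (Real.exp_pos _).le).trans ?_)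
      rw [mul_assoc, ← Real.exp_add]
      apply le_of_eq
      congr 2
      push_cast
      ring

theorem aux_finish (C : Set (PG2 F)) (hC : IsConic C) (k : ℕ) :
    ∀ S ⊆ C, 3 ≤ S.ncard → (auxU C S).ncard ≤ k →
      ∃ S' ⊆ C, S'.ncard ≤ S.ncard + k ∧ ∀ P ∈ Mset C, Covered S' P := by
  have hfin : Finite (PG2 F) := inferInstance
  induction k with
  | zero =>
    intro S hS _ hU
    refine ⟨S, hS, le_rfl, fun P hP => ?_⟩
    by_contra h
    have := (Set.ncard_eq_zero (Set.toFinite _)).1 (Nat.le_zero.1 hU)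
    have hm : P ∈ auxU C S := ⟨hP, h⟩
    rw [this] at hm
    exact hm
  | succ k ih =>
    intro S hS h3 hU
    by_cases hall : ∀ P ∈ Mset C, Covered S P
    · exact ⟨S, hS, by omega, hall⟩
    · push Not at hall
      obtain ⟨P, hP, hPn⟩ := hall
      have h1 := aux_cover C hC S hS P hP hPn
      obtain ⟨A, hA, hcov⟩ := (Set.ncard_pos (Set.toFinite _)).1
        (by omega : 0 < {A ∈ C \ S | Covered (insert A S) P}.ncard)
      have hlt : (auxU C (insert A S)).ncard < (auxU C S).ncard := by
        apply Set.ncard_lt_ncard _ (Set.toFinite _)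
        refine ⟨fun x hx => ⟨hx.1, fun h => hx.2 (aux_covered_mono (Set.subset_insert _ _) h)⟩,
          fun h => ?_⟩
        exact (h (⟨hP, hPn⟩ : P ∈ auxU C S)).2 hcov
      have hci := Set.ncard_insert_of_notMem hA.2 (Set.toFinite _)
      obtain ⟨S', hS', hc', hh⟩ := ih (insert A S) (Set.insert_subset hA.1 hS) (by omega)
        (by omega)
      exact ⟨S', hS', by omega, hh⟩

theorem aux_tAC_le (C : Set (PG2 F)) (hC : IsConic C) (S : Set (PG2 F)) (hS : S ⊆ C)
    (hlt : S.ncard ≤ Fintype.card F) (hcov : ∀ P ∈ Mset C, Covered S P) :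
    tAC C ≤ S.ncard := by
  apply Nat.sInf_le
  refine ⟨S, ⟨⟨hS, fun h => ?_⟩, hcov⟩, rfl⟩
  have : S = C := Set.Subset.antisymm hS h
  have h2 := hC.2.2
  rw [← this] at h2
  omega

theorem aux_tAC_le_q (C : Set (PG2 F)) (hC : IsConic C) (hq : 9 ≤ Fintype.card F) :
    tAC C ≤ Fintype.card F := by
  have hfin : Finite (PG2 F) := inferInstance
  have hcard := hC.2.2
  obtain ⟨X, hX⟩ := (Set.ncard_pos (Set.toFinite C)).1 (by omega)
  have h1 := Set.ncard_sdiff_singleton_add_one hX (Set.toFinite C)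
  have h2 : (C \ {X}).ncard = Fintype.card F := by omega
  rw [← h2]
  refine aux_tAC_le C hC _ Set.sdiff_subset h2.le ?_
  intro P hP
  by_contra hn
  have h3 := aux_cover C hC _ Set.sdiff_subset P hP hn
  have h4 : {A ∈ C \ (C \ {X}) | Covered (insert A (C \ {X})) P}.ncard ≤ ({X} : Set (PG2 F)).ncard := by
    apply Set.ncard_le_ncard _ (Set.toFinite _)
    intro A hA
    by_contra hAX
    exact hA.1.2 ⟨hA.1.1, hAX⟩
  rw [Set.ncard_singleton] at h4
  omega

/-- Bound C: `t(q) < √(q(3 ln q + ln ln q + ln 3)) + √(q/(3 ln q)) + 4`. -/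
theorem tAC_lt_Phi (q : ℕ) (hq : Fintype.card F = q) (hq9 : 9 ≤ q)
    (C : Set (PG2 F)) (hC : IsConic C) :
    (tAC C : ℝ) <
      Real.sqrt ((q : ℝ) * (3 * Real.log q + Real.log (Real.log q) + Real.log 3)) +
        Real.sqrt ((q : ℝ) / (3 * Real.log q)) + 4 := by
  subst hq
  have hle := aux_tAC_le_q C hC hq9
  have hgreedy := aux_greedy C hC
  have hfinish := aux_finish C hC
  have htle := aux_tAC_le C hC
  generalize Fintype.card F = q at *
  have hqR : (9 : ℝ) ≤ q := by exact_mod_cast hq9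
  have hlog1 : 1 < Real.log q := by
    rw [Real.lt_log_iff_exp_lt (by linarith)]
    have := Real.exp_one_lt_d9
    linarith
  have hll : 0 < Real.log (Real.log q) := Real.log_pos hlog1
  have hl3 : 0 < Real.log 3 := Real.log_pos (by norm_num)
  set L := 3 * Real.log q + Real.log (Real.log q) + Real.log 3 with hL
  set ξ := Real.sqrt ((q : ℝ) / (3 * Real.log q)) with hξ
  have hLpos : 0 < L := by rw [hL]; linarith
  have harg : 0 < (q : ℝ) / (3 * Real.log q) := by positivity
  have hξpos : 0 < ξ := Real.sqrt_pos.2 harg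
  have hlogξ : Real.log ξ = (Real.log q - (Real.log 3 + Real.log (Real.log q))) / 2 := by
    rw [hξ, Real.log_sqrt harg.le, Real.log_div (by linarith) (by linarith),
      Real.log_mul (by norm_num) (by linarith)]
  by_contra hcon
  push Not at hcon
  have hleR : (tAC C : ℝ) ≤ q := by exact_mod_cast hle
  set s := Real.sqrt ((q : ℝ) * L) with hs
  have hs0 : 0 ≤ s := Real.sqrt_nonneg _
  have hs2 : s * s = q * L := Real.mul_self_sqrt (by positivity)
  have hceil := Nat.ceil_lt_add_one hs0
  have hceil2 := Nat.le_ceil s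
  set N := ⌈s⌉₊ with hN
  have hNq : N + 1 + 2 ≤ q := by
    have : ((N + 1 + 2 : ℕ) : ℝ) ≤ q := by push_cast; linarith
    exact_mod_cast this
  obtain ⟨S, hS, hSc, hSu⟩ := hgreedy (N + 1) hNq
  have hU : ((auxU C S).ncard : ℝ) ≤ ξ := by
    refine hSu.trans ?_
    rw [← Real.exp_log hξpos, hlogξ]
    have hq2 : (q : ℝ) ^ 2 = Real.exp (2 * Real.log q) := by
      rw [mul_comm, Real.exp_mul, Real.exp_log (by linarith)]; norm_num
    rw [hq2, ← Real.exp_add]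
    apply Real.exp_le_exp.2
    push_cast
    have hkey : L / 2 ≤ ((N : ℝ) + 1) * (N + 1 - 1) / 2 / ((q : ℝ) - 1) := by
      rw [le_div_iff₀ (by linarith)]
      nlinarith
    rw [hL] at hkey
    linarith
  obtain ⟨S', hS', hc', hcov⟩ := hfinish (auxU C S).ncard S hS (by omega) le_rfl
  have hcR : (S'.ncard : ℝ) < s + ξ + 4 := by
    have : (S'.ncard : ℝ) ≤ S.ncard + (auxU C S).ncard := by exact_mod_cast hc'
    rw [hSc] at this
    push_cast at this
    linarith
  have hSq : S'.ncard ≤ q := by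
    have : (S'.ncard : ℝ) ≤ q := by linarith
    exact_mod_cast this
  have hfinal : (tAC C : ℝ) ≤ S'.ncard := by exact_mod_cast htle S' hS' hSq hcov
  linarith
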